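/- There exists a rooted digraph D (of size 2^ℵ0) such that no vertex-flame F ⊆ D preserves all Erdős–Menger separations of D; that is, for every vertex-flame F ⊆ D there exist a vertex v ∈ V−r and a separation S ∈ 𝔖_D(v) with S ∉ 𝔖_F(v). -/

import Mathlib

namespace FlamePaper

universe u
variable {V : Type u}

/-- A (nonempty, repetition-free) directed path, given by the list of its vertices;
its edge set consists of the pairs of consecutive vertices. A one-vertex list is the
trivial `v→v` path. -/
structure DiPath (V : Type u) where
  verts : List V
  ne : verts ≠ []
  nodup : verts.Nodup

namespace DiPath
variable (P : DiPath V)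
def first : V := P.verts.head P.ne
def last : V := P.verts.getLast P.ne
def vertexSet : Set V := {x | x ∈ P.verts}
def edges : Set (V × V) := {e | e ∈ P.verts.zip P.verts.tail}
def internal : Set V := P.vertexSet \ {P.first, P.last}
/-- The last edge of `P` (as a set; empty for the trivial path). -/
def lastEdge : Set (V × V) := {e ∈ P.edges | e.2 = P.last}
end DiPath

/-- `P` is a path of the digraph `D`. -/
def IsPathIn (D : Set (V × V)) (P : DiPath V) : Prop := P.edges ⊆ D

/-- `P` is an `a→b` path in `D`. -/
def IsPath (D : Set (V × V)) (a b : V) (P : DiPath V) : Prop :=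
  IsPathIn D P ∧ P.first = a ∧ P.last = b

/-- The set of ingoing edges of `v` in `D`. -/
def inEdges (D : Set (V × V)) (v : V) : Set (V × V) := {e ∈ D | e.2 = v}

/-- The set of outgoing edges of `v` in `D`. -/
def outEdges (D : Set (V × V)) (v : V) : Set (V × V) := {e ∈ D | e.1 = v}

/-- A rooted digraph: the root has no ingoing edges. -/
def IsRooted (D : Set (V × V)) (r : V) : Prop := inEdges D r = ∅

/-- `Ps` is a system of internally disjoint `r→v` paths in `D`: any two distinct
members share exactly the vertices `r` and `v`. -/
def IntDisjSystem (D : Set (V × V)) (r v : V) (Ps : Set (DiPath V)) : Prop :=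
  (∀ P ∈ Ps, IsPath D r v P) ∧
  ∀ P ∈ Ps, ∀ Q ∈ Ps, P ≠ Q → P.vertexSet ∩ Q.vertexSet = {r, v}

/-- `A_last(Ps)`: the set of last edges of the paths in `Ps`. -/
def lastEdges (Ps : Set (DiPath V)) : Set (V × V) := ⋃ P ∈ Ps, P.lastEdge

/-- `𝒢_D(v)`: the set of those `I ⊆ in_D(v)` which arise as the set of last edges
of a system of internally disjoint `r→v` paths of `D`. -/
def GSet (D : Set (V × V)) (r v : V) : Set (Set (V × V)) :=
  {I | ∃ Ps, IntDisjSystem D r v Ps ∧ lastEdges Ps = I}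

/-- `Ps ∈ ℑ_D(v)`: an internally disjoint system of `r→v` paths of `D` from each member
of which one can choose either an internal vertex or an edge so that the resulting set
meets every `r→v` path of `D`. -/
def EMSystem (D : Set (V × V)) (r v : V) (Ps : Set (DiPath V)) : Prop :=
  IntDisjSystem D r v Ps ∧
  ∃ sel : DiPath V → V ⊕ (V × V),
    (∀ P ∈ Ps, (∀ x, sel P = Sum.inl x → x ∈ P.internal) ∧
              (∀ e, sel P = Sum.inr e → e ∈ P.edges)) ∧
    ∀ Q : DiPath V, IsPath D r v Q →
      ∃ P ∈ Ps, (∀ x, sel P = Sum.inl x → x ∈ Q.vertexSet) ∧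
               (∀ e, sel P = Sum.inr e → e ∈ Q.edges)

/-- The path-system `Ps` lies in `L`. -/
def LiesIn (Ps : Set (DiPath V)) (L : Set (V × V)) : Prop := ∀ P ∈ Ps, IsPathIn L P

/-- `L` is a `D`-vertex-large spanning subdigraph of `D`. -/
def IsLarge (D L : Set (V × V)) (r : V) : Prop :=
  L ⊆ D ∧ ∀ v, v ≠ r → ∃ Ps, EMSystem D r v Ps ∧ LiesIn Ps L

/-- `F` is a vertex-flame with root `r`. -/
def IsFlame (F : Set (V × V)) (r : V) : Prop :=
  ∀ v, v ≠ r → inEdges F v ∈ GSet F r v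

/-- `F` is a quasi-vertex-flame with root `r`. -/
def IsQuasiFlame (F : Set (V × V)) (r : V) : Prop :=
  ∀ v, v ≠ r → ∀ I ⊆ inEdges F v, I.Finite → I ∈ GSet F r v

/-- `S` separates `b` from `a` in `D`: every `a→b` path of `D` meets `S`. -/
def Separates (D : Set (V × V)) (a b : V) (S : Set V) : Prop :=
  ∀ P : DiPath V, IsPath D a b P → (P.vertexSet ∩ S).Nonempty

/-- `𝔖_D(v)`: the Erdős–Menger separations corresponding to `v`. -/
def SepSet (D : Set (V × V)) (r v : V) : Set (Set V) :=
  {S | r ∉ S ∧ v ∉ S ∧ Separates (D \ {(r, v)}) r v S ∧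
    ∃ Ps, IntDisjSystem D r v Ps ∧
      ∃ sel : DiPath V → V, (∀ P ∈ Ps, sel P ∈ P.internal) ∧ S = sel '' Ps}

/-- The entrance of `X` with respect to `D`. -/
def entrance (D : Set (V × V)) (X : Set V) : Set V :=
  {v ∈ X | ∃ u, u ∉ X ∧ (u, v) ∈ D}

/-- `int_D(X) = X ∖ ent_D(X)`. -/
def interiorSet (D : Set (V × V)) (X : Set V) : Set V := X \ entrance D X

/-- `B` is a `v`-bubble of `D` (with root `r`): `B ⊆ V − r` and there is a `v`-infan
`{P_u : u ∈ ent_D(B)}` in `D ∩ (B × B)` where `P_u` starts at `u`. -/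
def IsBubble (D : Set (V × V)) (r v : V) (B : Set V) : Prop :=
  r ∉ B ∧
  ∃ F : V → DiPath V,
    (∀ u ∈ entrance D B, IsPath (D ∩ B ×ˢ B) u v (F u)) ∧
    ∀ u ∈ entrance D B, ∀ u' ∈ entrance D B, u ≠ u' →
      (F u).vertexSet ∩ (F u').vertexSet = {v}

/-- `bubb_D(v)`. -/
def bubbles (D : Set (V × V)) (r v : V) : Set (Set V) := {B | IsBubble D r v B}

/-- `B_{v,D}`: the union of all `v`-bubbles of `D`. -/
def maxBubble (D : Set (V × V)) (r v : V) : Set V := ⋃₀ bubbles D r v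

/-- `B_{S,v,D}`: the set of vertices `u` such that every `r→u` path of `D−rv` meets `S`. -/
def Bset (D : Set (V × V)) (r v : V) (S : Set V) : Set V :=
  {u | ∀ P : DiPath V, IsPath (D \ {(r, v)}) r u P → (P.vertexSet ∩ S).Nonempty}

/-- `Ps` is an `r`-fan in `D`: paths of `D` starting at `r`, any two distinct members
having only the vertex `r` in common. -/
def IsRFan (D : Set (V × V)) (r : V) (Ps : Set (DiPath V)) : Prop :=
  (∀ P ∈ Ps, IsPathIn D P ∧ P.first = r) ∧
  ∀ P ∈ Ps, ∀ Q ∈ Ps, P ≠ Q → P.vertexSet ∩ Q.vertexSet = {r}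

/-- The set of first vertices of the paths in `Ps`. -/
def Vfirst (Ps : Set (DiPath V)) : Set V := DiPath.first '' Ps

/-- The set of last vertices of the paths in `Ps`. -/
def Vlast (Ps : Set (DiPath V)) : Set V := DiPath.last '' Ps

/-- `P` is an `X→Y` path in `D`: exactly its first vertex lies in `X` and
exactly its last vertex lies in `Y`. -/
def IsXYPath (D : Set (V × V)) (X Y : Set V) (P : DiPath V) : Prop :=
  IsPathIn D P ∧ P.vertexSet ∩ X = {P.first} ∧ P.vertexSet ∩ Y = {P.last}

/-- `Ps` is a system of pairwise (vertex-)disjoint `X→Y` paths of `D`. -/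
def DisjXYSystem (D : Set (V × V)) (X Y : Set V) (Ps : Set (DiPath V)) : Prop :=
  (∀ P ∈ Ps, IsXYPath D X Y P) ∧
  ∀ P ∈ Ps, ∀ Q ∈ Ps, P ≠ Q → P.vertexSet ∩ Q.vertexSet = ∅

/-- `κ_D(r,v)`: the maximum size of a (finite) system of internally disjoint `r→v`
paths of `D`. -/
noncomputable def kappa (D : Set (V × V)) (r v : V) : ℕ :=
  sSup {n : ℕ | ∃ Ps : Set (DiPath V), IntDisjSystem D r v Ps ∧ Ps.Finite ∧ Ps.ncard = n}

namespace DiPath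

theorem mem_of_mem_edges {P : DiPath V} {u v : V} (h : (u, v) ∈ P.edges) :
    u ∈ P.vertexSet ∧ v ∈ P.vertexSet :=
  ⟨(List.of_mem_zip h).1, List.mem_of_mem_tail (List.of_mem_zip h).2⟩

theorem exists_mem_edges_of_ne_first {P : DiPath V} {v : V} (hv : v ∈ P.vertexSet)
    (hne : v ≠ P.first) : ∃ u, (u, v) ∈ P.edges := by
  obtain ⟨l, hl, hn⟩ := P
  simp only [vertexSet, Set.mem_ofPred_eq, first] at hv hne
  obtain ⟨i, hi, rfl⟩ := List.getElem_of_mem hv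
  cases i with
  | zero => exact absurd (List.head_eq_getElem hl).symm hne
  | succ i =>
    refine ⟨l[i], List.mem_iff_getElem.2 ⟨i, ?_, ?_⟩⟩
    · simp only [List.length_zip, List.length_tail]
      omega
    · simp

theorem eq_of_mem_edges {P : DiPath V} {u u' v : V} (h : (u, v) ∈ P.edges)
    (h' : (u', v) ∈ P.edges) : u = u' := by
  obtain ⟨l, hl, hn⟩ := P
  obtain ⟨i, hi, h⟩ := List.mem_iff_getElem.1 h
  obtain ⟨j, hj, h'⟩ := List.mem_iff_getElem.1 h'
  simp only [List.getElem_zip, List.getElem_tail, Prod.mk.injEq] at h h'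
  have hij := (hn.getElem_inj_iff).1 (h.2.trans h'.2.symm)
  obtain rfl : i = j := by omega
  exact h.1.symm.trans h'.1

theorem last_mem (P : DiPath V) : P.last ∈ P.vertexSet := List.getLast_mem P.ne

end DiPath

/-- In an internally disjoint system, paths through a common inner vertex coincide. -/
theorem IntDisjSystem.eq_of_mem {D : Set (V × V)} {r v u : V} {Ps : Set (DiPath V)}
    (h : IntDisjSystem D r v Ps) {P Q : DiPath V} (hP : P ∈ Ps) (hQ : Q ∈ Ps)
    (huP : u ∈ P.vertexSet) (huQ : u ∈ Q.vertexSet) (hr : u ≠ r) (hv : u ≠ v) : P = Q := by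
  by_contra hne
  have hu : u ∈ P.vertexSet ∩ Q.vertexSet := ⟨huP, huQ⟩
  rw [h.2 P hP Q hQ hne] at hu
  exact hu.elim hr hv

/-- Vertices of the counterexample: a root, a countable layer `a`, a layer `x` of size
continuum, a collecting vertex `w`, and a vertex `v g` for each sequence `g` in the layer `x`. -/
inductive Vertex : Type
  | r
  | a (n : ℕ)
  | x (t : ℝ)
  | w
  | v (g : ℕ → ℝ)

namespace Vertex

/-- Adjacency in the counterexample. -/
inductive Adj : Vertex → Vertex → Prop
  | r_a (n : ℕ) : Adj r (a n)
  | a_x (n : ℕ) (t : ℝ) : Adj (a n) (x t)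
  | x_w (t : ℝ) : Adj (x t) w
  | x_v (g : ℕ → ℝ) (t : ℝ) (h : t ∈ Set.range g) : Adj (x t) (v g)
  | w_v (g : ℕ → ℝ) : Adj w (v g)

/-- The counterexample. -/
def digraph : Set (Vertex × Vertex) := {e | Adj e.1 e.2}

theorem isRooted_digraph : IsRooted digraph r := by
  ext ⟨u, z⟩
  simp only [inEdges, digraph, Set.mem_ofPred_eq, Set.mem_empty_iff_false, iff_false, not_and]
  rintro h rfl
  cases h

/-- An injection of the vertices into a set of size continuum. -/
def code : Vertex → ℕ × (ℕ → ℝ)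
  | r => (0, 0)
  | w => (1, 0)
  | x t => (2, fun _ => t)
  | v g => (3, g)
  | a n => (n + 4, 0)

theorem code_injective : Function.Injective code := by
  intro u z h
  cases u <;> cases z <;> simp_all [code, funext_iff]

theorem mk_digraph : Cardinal.mk ↥digraph = 2 ^ Cardinal.aleph0 := by
  rw [Cardinal.two_power_aleph0]
  apply le_antisymm
  · have hV : Cardinal.mk Vertex ≤ Cardinal.continuum := by
      refine (Cardinal.mk_le_of_injective code_injective).trans ?_
      simp [Cardinal.mk_real]
    refine (Cardinal.mk_set_le _).trans ?_
    rw [Cardinal.mk_prod, Cardinal.lift_id, ← Cardinal.continuum_mul_self]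
    exact mul_le_mul' hV hV
  · rw [← Cardinal.mk_real]
    refine Cardinal.mk_le_of_injective (f := fun t : ℝ => (⟨(x t, w), Adj.x_w t⟩ : digraph)) ?_
    intro s t h
    simpa only [Prod.mk.injEq, x.injEq, and_true] using congrArg Subtype.val h

/-- A flame in the counterexample has only countably many edges entering `w`. -/
theorem countable_setOf_mem_of_isFlame {F : Set (Vertex × Vertex)} (hF : F ⊆ digraph)
    (hflame : IsFlame F r) : {t : ℝ | (x t, w) ∈ F}.Countable := by
  obtain ⟨Ps, hPs, hlast⟩ := hflame w (by simp)
  have key : ∀ t : ℝ, (x t, w) ∈ F →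
      ∃ P ∈ Ps, (x t, w) ∈ P.edges ∧ ∃ n, a n ∈ P.vertexSet := by
    intro t ht
    have hmem : (x t, w) ∈ lastEdges Ps := by
      rw [hlast]
      exact ⟨ht, rfl⟩
    simp only [lastEdges, Set.mem_iUnion] at hmem
    obtain ⟨P, hP, he, -⟩ := hmem
    obtain ⟨hin, hfirst, -⟩ := hPs.1 P hP
    obtain ⟨u, hu⟩ := DiPath.exists_mem_edges_of_ne_first
      (DiPath.mem_of_mem_edges he).1 (by rw [hfirst]; simp)
    have hadj : Adj u (x t) := hF (hin hu)
    cases hadj with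
    | a_x n => exact ⟨P, hP, he, n, (DiPath.mem_of_mem_edges hu).1⟩
  choose! P hP he n hn using key
  refine Set.countable_iff_exists_injOn.2 ⟨n, fun s hs t ht hst => ?_⟩
  have hPQ : P s hs = P t ht := hPs.eq_of_mem (hP s hs) (hP t ht) (hn s hs)
    (by rw [hst]; exact hn t ht) (by simp) (by simp)
  have h := DiPath.eq_of_mem_edges (he s hs) (by rw [hPQ]; exact he t ht)
  simpa using h

/-- The path `r → a n → x t → v g`. -/
def directPath (g : ℕ → ℝ) (n : ℕ) (t : ℝ) : DiPath Vertex :=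
  ⟨[r, a n, x t, v g], by simp, by simp⟩

/-- The path `r → a n → x t → w → v g`. -/
def detourPath (g : ℕ → ℝ) (n : ℕ) (t : ℝ) : DiPath Vertex :=
  ⟨[r, a n, x t, w, v g], by simp, by simp⟩

theorem isPath_directPath {g : ℕ → ℝ} {t : ℝ} (n : ℕ) (ht : t ∈ Set.range g) :
    IsPath digraph r (v g) (directPath g n t) := by
  refine ⟨?_, rfl, rfl⟩
  intro e he
  simp only [DiPath.edges, directPath, List.tail_cons, List.zip_cons_cons, List.zip_nil_right,
    List.mem_cons, List.not_mem_nil, or_false, Set.mem_ofPred_eq] at he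
  rcases he with rfl | rfl | rfl
  exacts [Adj.r_a n, Adj.a_x n t, Adj.x_v g t ht]

theorem isPath_detourPath (g : ℕ → ℝ) (n : ℕ) (t : ℝ) :
    IsPath digraph r (v g) (detourPath g n t) := by
  refine ⟨?_, rfl, rfl⟩
  intro e he
  simp only [DiPath.edges, detourPath, List.tail_cons, List.zip_cons_cons, List.zip_nil_right,
    List.mem_cons, List.not_mem_nil, or_false, Set.mem_ofPred_eq] at he
  rcases he with rfl | rfl | rfl | rfl
  exacts [Adj.r_a n, Adj.a_x n t, Adj.x_w t, Adj.w_v g]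

/-- The set of in-neighbours of `v g`. -/
def inNeighbours (g : ℕ → ℝ) : Set Vertex := insert w (x '' Set.range g)

theorem separates_inNeighbours (g : ℕ → ℝ) :
    Separates (digraph \ {(r, v g)}) r (v g) (inNeighbours g) := by
  rintro P ⟨hin, hfirst, hlast⟩
  obtain ⟨u, hu⟩ := DiPath.exists_mem_edges_of_ne_first P.last_mem
    (by rw [hfirst, hlast]; simp)
  rw [hlast] at hu
  refine ⟨u, (DiPath.mem_of_mem_edges hu).1, ?_⟩
  have hadj : Adj u (v g) := (hin hu).1
  cases hadj with
  | x_v _ t ht => exact Or.inr ⟨t, ht, rfl⟩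
  | w_v => exact Or.inl rfl

open Classical in
theorem inNeighbours_mem_sepSet (g : ℕ → ℝ) : inNeighbours g ∈ SepSet digraph r (v g) := by
  have hcount : (Set.range g).Countable := Set.countable_range g
  obtain ⟨T, hT⟩ : ∃ T, T ∉ Set.range g := by
    by_contra! h
    exact Cardinal.not_countable_real (hcount.mono fun t _ => h t)
  obtain ⟨f, hf⟩ := Set.countable_iff_exists_injOn.1 (hcount.insert T)
  refine ⟨by simp [inNeighbours], by simp [inNeighbours], separates_inNeighbours g,
    insert (detourPath g (f T) T) ((fun t => directPath g (f t) t) '' Set.range g), ⟨?_, ?_⟩,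
    fun P => if w ∈ P.vertexSet then w else P.verts.getD 2 r, ?_, ?_⟩
  · rintro P (rfl | ⟨t, ht, rfl⟩)
    exacts [isPath_detourPath g _ T, isPath_directPath _ ht]
  · have hdir : ∀ t ∈ Set.range g,
        (detourPath g (f T) T).vertexSet ∩ (directPath g (f t) t).vertexSet = {r, v g} := by
      intro t ht
      have hne : T ≠ t := fun h => hT (h ▸ ht)
      have hfne : f T ≠ f t := fun h => hne (hf (by simp) (Or.inr ht) h)
      ext u
      cases u <;> simp [DiPath.vertexSet, directPath, detourPath] <;> grind
    rintro P (rfl | ⟨s, hs, rfl⟩) Q (rfl | ⟨t, ht, rfl⟩) hPQ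
    · exact absurd rfl hPQ
    · exact hdir t ht
    · rw [Set.inter_comm]
      exact hdir s hs
    · have hne : s ≠ t := by
        rintro rfl
        exact hPQ rfl
      have hfne : f s ≠ f t := fun h => hne (hf (Or.inr hs) (Or.inr ht) h)
      ext u
      cases u <;> simp [DiPath.vertexSet, directPath] <;> grind
  · rintro P (rfl | ⟨t, ht, rfl⟩)
    · simp [DiPath.internal, DiPath.vertexSet, DiPath.first, DiPath.last, detourPath]
    · simp [DiPath.internal, DiPath.vertexSet, DiPath.first, DiPath.last, directPath]
  · rw [Set.image_insert_eq, Set.image_image]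
    simp [DiPath.vertexSet, detourPath, directPath, inNeighbours]

/-- If every edge of `F` entering `w` starts in the range of `g`, then `F` does not preserve
the separation of `v g` formed by its in-neighbours. -/
theorem inNeighbours_notMem_sepSet {F : Set (Vertex × Vertex)} (hF : F ⊆ digraph) {g : ℕ → ℝ}
    (hg : {t : ℝ | (x t, w) ∈ F} ⊆ Set.range g) : inNeighbours g ∉ SepSet F r (v g) := by
  rintro ⟨-, -, -, Ps, hPs, sel, hsel, hS⟩
  obtain ⟨P, hP, hPw⟩ : w ∈ sel '' Ps := hS ▸ Or.inl rfl
  obtain ⟨hin, hfirst, -⟩ := hPs.1 P hP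
  have hw : w ∈ P.vertexSet := hPw ▸ (hsel P hP).1
  obtain ⟨u, hu⟩ := DiPath.exists_mem_edges_of_ne_first hw (by rw [hfirst]; simp)
  have hadj : Adj u w := hF (hin hu)
  cases hadj with
  | x_w t =>
    obtain ⟨Q, hQ, hQt⟩ : x t ∈ sel '' Ps := hS ▸ Or.inr ⟨t, hg (hin hu), rfl⟩
    have hPQ : P = Q := hPs.eq_of_mem hP hQ (DiPath.mem_of_mem_edges hu).1
      (hQt ▸ (hsel Q hQ).1) (by simp) (by simp)
    rw [hPQ, hQt] at hPw
    cases hPw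

end Vertex

/-- There is a rooted digraph `D` of size `2^ℵ₀` such that no vertex-flame `F ⊆ D`
preserves all Erdős–Menger separations of `D`. -/
theorem no_flame_preserving_all_separations :
    ∃ (V : Type) (r : V) (D : Set (V × V)),
      IsRooted D r ∧ Cardinal.mk ↥D = 2 ^ Cardinal.aleph0 ∧
      ∀ F ⊆ D, IsFlame F r →
        ∃ v, v ≠ r ∧ ∃ S ∈ SepSet D r v, S ∉ SepSet F r v := by
  refine ⟨Vertex, .r, Vertex.digraph, Vertex.isRooted_digraph, Vertex.mk_digraph,
    fun F hF hflame => ?_⟩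
  obtain ⟨g, hg⟩ : ∃ g : ℕ → ℝ, {t : ℝ | (Vertex.x t, Vertex.w) ∈ F} ⊆ Set.range g :=
    Set.countable_iff_exists_subset_range.1 (Vertex.countable_setOf_mem_of_isFlame hF hflame)
  exact ⟨.v g, by simp, Vertex.inNeighbours g, Vertex.inNeighbours_mem_sepSet g,
    Vertex.inNeighbours_notMem_sepSet hF hg⟩

end FlamePaper
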